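/- Let 0 < p₀ < p₁ < 1, κ > 0, and let f : [p₀,p₁] → [0,1) be a differentiable function satisfying f'(p) ≥ (κ/(p(1-p)))·(1 - f(p)) for all p ∈ [p₀,p₁]. Then f(p₁) ≥ 1 - (1 - f(p₀)) · ( ((1-p₁)/p₁) · (p₀/(1-p₀)) )^κ. -/

import Mathlib

open Set

/-- Integrated form of the one-arm differential inequality: if `f : [p₀,p₁] → [0,1)` is
differentiable with `f'(p) ≥ (κ/(p(1-p))) (1 - f(p))` on `[p₀,p₁] ⊆ (0,1)` and `κ > 0`,
then `f(p₁) ≥ 1 - (1 - f(p₀)) ((1-p₁)/p₁ ⬝ p₀/(1-p₀))^κ`. -/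
theorem integrated_differential_inequality (p₀ p₁ κ : ℝ) (f f' : ℝ → ℝ)
    (hp₀ : 0 < p₀) (hp : p₀ < p₁) (hp₁ : p₁ < 1) (hκ : 0 < κ)
    (hrange : ∀ p ∈ Set.Icc p₀ p₁, f p ∈ Set.Ico (0:ℝ) 1)
    (hderiv : ∀ p ∈ Set.Icc p₀ p₁, HasDerivWithinAt f (f' p) (Set.Icc p₀ p₁) p)
    (hineq : ∀ p ∈ Set.Icc p₀ p₁, f' p ≥ κ / (p * (1 - p)) * (1 - f p)) :
    f p₁ ≥ 1 - (1 - f p₀) * ((1 - p₁) / p₁ * (p₀ / (1 - p₀))) ^ κ := by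
  have hpos : ∀ p ∈ Icc p₀ p₁, 0 < p ∧ 0 < 1 - p ∧ 0 < 1 - f p := fun p h =>
    ⟨by linarith [h.1], by linarith [h.2], by linarith [(hrange p h).2]⟩
  have hder : ∀ p ∈ Icc p₀ p₁, HasDerivWithinAt
      (fun p => Real.log (1 - f p) + κ * (Real.log p - Real.log (1 - p)))
      (-f' p / (1 - f p) + κ * (1 / p - -1 / (1 - p))) (Icc p₀ p₁) p := by
    intro p h
    obtain ⟨hp0, hq0, hf0⟩ := hpos p h
    exact (((hderiv p h).const_sub 1).log hf0.ne').add
      ((((hasDerivWithinAt_id p _).log hp0.ne').sub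
        (((hasDerivWithinAt_id p _).const_sub 1).log hq0.ne')).const_mul κ)
  have hanti : AntitoneOn
      (fun p => Real.log (1 - f p) + κ * (Real.log p - Real.log (1 - p))) (Icc p₀ p₁) := by
    refine antitoneOn_of_hasDerivWithinAt_nonpos (convex_Icc p₀ p₁)
      (fun p h => (hder p h).continuousWithinAt)
      (fun p h => (hder p (interior_subset h)).mono interior_subset) ?_
    intro p h
    obtain ⟨hp0, hq0, hf0⟩ := hpos p (interior_subset h)
    have hle := (le_div_iff₀ hf0).2 (hineq p (interior_subset h))
    have heq : κ * (1 / p - -1 / (1 - p)) = κ / (p * (1 - p)) := by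
      field_simp
      ring
    rw [heq, neg_div]
    linarith
  have hmem₀ : p₀ ∈ Icc p₀ p₁ := left_mem_Icc.2 hp.le
  have hmem₁ : p₁ ∈ Icc p₀ p₁ := right_mem_Icc.2 hp.le
  have hle := hanti hmem₀ hmem₁ hp.le
  obtain ⟨-, hq₀, hf₀⟩ := hpos p₀ hmem₀
  obtain ⟨hp₁', hq₁, hf₁⟩ := hpos p₁ hmem₁
  have hbase : 0 < (1 - p₁) / p₁ * (p₀ / (1 - p₀)) := by positivity
  have hmain : 1 - f p₁ ≤ (1 - f p₀) * ((1 - p₁) / p₁ * (p₀ / (1 - p₀))) ^ κ := by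
    rw [← Real.log_le_log_iff hf₁ (by positivity),
      Real.log_mul hf₀.ne' (by positivity), Real.log_rpow hbase,
      Real.log_mul (by positivity) (by positivity), Real.log_div hq₁.ne' hp₁'.ne',
      Real.log_div hp₀.ne' hq₀.ne']
    dsimp only at hle
    linarith
  linarith
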